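/- Let (u,v) be a smooth solution of the Pavlov–Mikhalev system on ℝ³ and let ϑ : ℝ → ℝ be an arbitrary smooth function of t, with derivatives ϑ_t, ϑ_tt. Then the pair (φ^u, φ^v) with φ^u = u_y·ϑ(t) + (y·u_x − x)·ϑ_t(t) − (1/2)·y²·ϑ_tt(t) and φ^v = v_y·ϑ(t) + y·v_x·ϑ_t(t) satisfies the linearized system, i.e., it is a symmetry generating function (the symmetry φ₅[ϑ]). -/

import Mathlib

noncomputable section

/-- Partial derivative with respect to the first coordinate `t`. -/
def Dt (f : ℝ → ℝ → ℝ → ℝ) : ℝ → ℝ → ℝ → ℝ := fun t x y => deriv (fun s => f s x y) t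

/-- Partial derivative with respect to the second coordinate `x`. -/
def Dx (f : ℝ → ℝ → ℝ → ℝ) : ℝ → ℝ → ℝ → ℝ := fun t x y => deriv (fun s => f t s y) x

/-- Partial derivative with respect to the third coordinate `y`. -/
def Dy (f : ℝ → ℝ → ℝ → ℝ) : ℝ → ℝ → ℝ → ℝ := fun t x y => deriv (fun s => f t x s) y

/-- `f` is a smooth function on `ℝ³` (given in curried form, coordinates `(t, x, y)`). -/
def Smooth3 (f : ℝ → ℝ → ℝ → ℝ) : Prop :=
  ContDiff ℝ (⊤ : ℕ∞) (fun p : ℝ × ℝ × ℝ => f p.1 p.2.1 p.2.2)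

/-- The Pavlov–Mikhalev equation `u_yy = u_xt − u_x·u_xy + u_y·u_xx`. -/
def PMu (u : ℝ → ℝ → ℝ → ℝ) : Prop :=
  ∀ t x y : ℝ, Dy (Dy u) t x y =
    Dt (Dx u) t x y - Dx u t x y * Dy (Dx u) t x y + Dy u t x y * Dx (Dx u) t x y

/-- The second equation of the two-component Pavlov–Mikhalev system:
`v_yy = v_xt − u_x·v_xy − 2·v_y·u_xx + 2·v_x·u_xy + u_y·v_xx`. -/
def PMv (u v : ℝ → ℝ → ℝ → ℝ) : Prop :=
  ∀ t x y : ℝ, Dy (Dy v) t x y =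
    Dt (Dx v) t x y - Dx u t x y * Dy (Dx v) t x y
      - 2 * Dy v t x y * Dx (Dx u) t x y + 2 * Dx v t x y * Dy (Dx u) t x y
      + Dy u t x y * Dx (Dx v) t x y

/-- First equation of the linearized system applied to `A = φ^u`:
`φ^u_yy = φ^u_xt + u_xx·φ^u_y + u_y·φ^u_xx − u_x·φ^u_xy − u_xy·φ^u_x`. -/
def LinU (u A : ℝ → ℝ → ℝ → ℝ) : Prop :=
  ∀ t x y : ℝ, Dy (Dy A) t x y =
    Dt (Dx A) t x y + Dx (Dx u) t x y * Dy A t x y + Dy u t x y * Dx (Dx A) t x y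
      - Dx u t x y * Dy (Dx A) t x y - Dy (Dx u) t x y * Dx A t x y

/-- Second equation of the linearized system applied to `(A, B) = (φ^u, φ^v)`. -/
def LinV (u v A B : ℝ → ℝ → ℝ → ℝ) : Prop :=
  ∀ t x y : ℝ, Dy (Dy B) t x y =
    2 * Dx v t x y * Dy (Dx A) t x y - Dy (Dx v) t x y * Dx A t x y
      + Dx (Dx v) t x y * Dy A t x y - 2 * Dy v t x y * Dx (Dx A) t x y
      + Dt (Dx B) t x y + 2 * Dy (Dx u) t x y * Dx B t x y
      - 2 * Dx (Dx u) t x y * Dy B t x y + Dy u t x y * Dx (Dx B) t x y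
      - Dx u t x y * Dy (Dx B) t x y

/-- `(A,B)` is a symmetry generating function of the Pavlov–Mikhalev system over `(u,v)`. -/
def IsSymmetry (u v A B : ℝ → ℝ → ℝ → ℝ) : Prop := LinU u A ∧ LinV u v A B

/-- First equation of the tangent system over a solution `(u,v)`:
`p_yy = u_y·p_xx − u_xy·p_x − u_x·p_xy + u_xx·p_y + p_xt`. -/
def TanP (u p : ℝ → ℝ → ℝ → ℝ) : Prop :=
  ∀ t x y : ℝ, Dy (Dy p) t x y =
    Dy u t x y * Dx (Dx p) t x y - Dy (Dx u) t x y * Dx p t x y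
      - Dx u t x y * Dy (Dx p) t x y + Dx (Dx u) t x y * Dy p t x y + Dt (Dx p) t x y

/-- Second equation of the tangent system over a solution `(u,v)`:
`q_yy = 2·v_x·p_xy + v_xx·p_y − v_xy·p_x − 2·v_y·p_xx + 2·u_xy·q_x + u_y·q_xx
  − u_x·q_xy − 2·u_xx·q_y + q_xt`. -/
def TanQ (u v p q : ℝ → ℝ → ℝ → ℝ) : Prop :=
  ∀ t x y : ℝ, Dy (Dy q) t x y =
    2 * Dx v t x y * Dy (Dx p) t x y + Dx (Dx v) t x y * Dy p t x y
      - Dy (Dx v) t x y * Dx p t x y - 2 * Dy v t x y * Dx (Dx p) t x y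
      + 2 * Dy (Dx u) t x y * Dx q t x y + Dy u t x y * Dx (Dx q) t x y
      - Dx u t x y * Dy (Dx q) t x y - 2 * Dx (Dx u) t x y * Dy q t x y
      + Dt (Dx q) t x y

namespace Smooth3

variable {f : ℝ → ℝ → ℝ → ℝ}

/-- The uncurried form of a function of three real variables. -/
def uncurry (f : ℝ → ℝ → ℝ → ℝ) (p : ℝ × ℝ × ℝ) : ℝ := f p.1 p.2.1 p.2.2

theorem hasFDerivAt (hf : Smooth3 f) (p : ℝ × ℝ × ℝ) :
    HasFDerivAt (uncurry f) (fderiv ℝ (uncurry f) p) p :=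
  (ContDiff.differentiable (f := uncurry f) hf (by simp) p).hasFDerivAt

theorem hasDerivAt_t' (hf : Smooth3 f) (t x y : ℝ) :
    HasDerivAt (fun s => f s x y) (fderiv ℝ (uncurry f) (t, x, y) (1, 0, 0)) t :=
  (hf.hasFDerivAt (t, x, y)).comp_hasDerivAt (f := fun s => (s, x, y)) t
    ((hasDerivAt_id t).prodMk ((hasDerivAt_const t x).prodMk (hasDerivAt_const t y)))

theorem hasDerivAt_x' (hf : Smooth3 f) (t x y : ℝ) :
    HasDerivAt (fun s => f t s y) (fderiv ℝ (uncurry f) (t, x, y) (0, 1, 0)) x :=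
  (hf.hasFDerivAt (t, x, y)).comp_hasDerivAt (f := fun s => (t, s, y)) x
    ((hasDerivAt_const x t).prodMk ((hasDerivAt_id x).prodMk (hasDerivAt_const x y)))

theorem hasDerivAt_y' (hf : Smooth3 f) (t x y : ℝ) :
    HasDerivAt (fun s => f t x s) (fderiv ℝ (uncurry f) (t, x, y) (0, 0, 1)) y :=
  (hf.hasFDerivAt (t, x, y)).comp_hasDerivAt (f := fun s => (t, x, s)) y
    ((hasDerivAt_const y t).prodMk ((hasDerivAt_const y x).prodMk (hasDerivAt_id y)))

theorem uncurry_Dt (hf : Smooth3 f) :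
    uncurry (Dt f) = fun p => fderiv ℝ (uncurry f) p (1, 0, 0) :=
  funext fun p => (hf.hasDerivAt_t' p.1 p.2.1 p.2.2).deriv

theorem uncurry_Dx (hf : Smooth3 f) :
    uncurry (Dx f) = fun p => fderiv ℝ (uncurry f) p (0, 1, 0) :=
  funext fun p => (hf.hasDerivAt_x' p.1 p.2.1 p.2.2).deriv

theorem uncurry_Dy (hf : Smooth3 f) :
    uncurry (Dy f) = fun p => fderiv ℝ (uncurry f) p (0, 0, 1) :=
  funext fun p => (hf.hasDerivAt_y' p.1 p.2.1 p.2.2).deriv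

theorem hasDerivAt_t (hf : Smooth3 f) (t x y : ℝ) :
    HasDerivAt (fun s => f s x y) (Dt f t x y) t :=
  (hf.hasDerivAt_t' t x y).differentiableAt.hasDerivAt

theorem hasDerivAt_x (hf : Smooth3 f) (t x y : ℝ) :
    HasDerivAt (fun s => f t s y) (Dx f t x y) x :=
  (hf.hasDerivAt_x' t x y).differentiableAt.hasDerivAt

theorem hasDerivAt_y (hf : Smooth3 f) (t x y : ℝ) :
    HasDerivAt (fun s => f t x s) (Dy f t x y) y :=
  (hf.hasDerivAt_y' t x y).differentiableAt.hasDerivAt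

theorem contDiff_fderiv_apply (hf : Smooth3 f) (w : ℝ × ℝ × ℝ) :
    ContDiff ℝ (⊤ : ℕ∞) fun p => fderiv ℝ (uncurry f) p w :=
  (ContDiff.fderiv_right (f := uncurry f) hf (by simp)).clm_apply contDiff_const

theorem smooth_Dt (hf : Smooth3 f) : Smooth3 (Dt f) := by
  change ContDiff ℝ (⊤ : ℕ∞) (uncurry (Dt f))
  rw [hf.uncurry_Dt]
  exact hf.contDiff_fderiv_apply _

theorem smooth_Dx (hf : Smooth3 f) : Smooth3 (Dx f) := by
  change ContDiff ℝ (⊤ : ℕ∞) (uncurry (Dx f))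
  rw [hf.uncurry_Dx]
  exact hf.contDiff_fderiv_apply _

theorem smooth_Dy (hf : Smooth3 f) : Smooth3 (Dy f) := by
  change ContDiff ℝ (⊤ : ℕ∞) (uncurry (Dy f))
  rw [hf.uncurry_Dy]
  exact hf.contDiff_fderiv_apply _

theorem fderiv_fderiv_apply_comm (hf : Smooth3 f) (p w z : ℝ × ℝ × ℝ) :
    fderiv ℝ (fun q => fderiv ℝ (uncurry f) q w) p z =
      fderiv ℝ (fun q => fderiv ℝ (uncurry f) q z) p w := by
  have hd : DifferentiableAt ℝ (fderiv ℝ (uncurry f)) p :=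
    (ContDiff.fderiv_right (f := uncurry f) (m := 1) hf (by norm_cast)).differentiable
      (by simp) p
  have hs : IsSymmSndFDerivAt ℝ (uncurry f) p :=
    ContDiffAt.isSymmSndFDerivAt (n := (⊤ : ℕ∞)) (ContDiff.contDiffAt (f := uncurry f) hf)
      (by simpa using (by norm_cast : (2 : WithTop ℕ∞) ≤ ((⊤ : ℕ∞) : WithTop ℕ∞)))
  rw [fderiv_clm_apply hd (differentiableAt_const w),
    fderiv_clm_apply hd (differentiableAt_const z)]
  simpa using hs z w

theorem Dx_Dy (hf : Smooth3 f) : Dx (Dy f) = Dy (Dx f) := by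
  funext t x y
  calc Dx (Dy f) t x y = fderiv ℝ (uncurry (Dy f)) (t, x, y) (0, 1, 0) :=
        (hf.smooth_Dy.hasDerivAt_x' t x y).deriv
    _ = fderiv ℝ (uncurry (Dx f)) (t, x, y) (0, 0, 1) := by
        rw [hf.uncurry_Dy, hf.uncurry_Dx, hf.fderiv_fderiv_apply_comm]
    _ = Dy (Dx f) t x y := (hf.smooth_Dx.hasDerivAt_y' t x y).deriv.symm

theorem Dt_Dy (hf : Smooth3 f) : Dt (Dy f) = Dy (Dt f) := by
  funext t x y
  calc Dt (Dy f) t x y = fderiv ℝ (uncurry (Dy f)) (t, x, y) (1, 0, 0) :=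
        (hf.smooth_Dy.hasDerivAt_t' t x y).deriv
    _ = fderiv ℝ (uncurry (Dt f)) (t, x, y) (0, 0, 1) := by
        rw [hf.uncurry_Dy, hf.uncurry_Dt, hf.fderiv_fderiv_apply_comm]
    _ = Dy (Dt f) t x y := (hf.smooth_Dt.hasDerivAt_y' t x y).deriv.symm

theorem Dt_Dx (hf : Smooth3 f) : Dt (Dx f) = Dx (Dt f) := by
  funext t x y
  calc Dt (Dx f) t x y = fderiv ℝ (uncurry (Dx f)) (t, x, y) (1, 0, 0) :=
        (hf.smooth_Dx.hasDerivAt_t' t x y).deriv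
    _ = fderiv ℝ (uncurry (Dt f)) (t, x, y) (0, 1, 0) := by
        rw [hf.uncurry_Dx, hf.uncurry_Dt, hf.fderiv_fderiv_apply_comm]
    _ = Dx (Dt f) t x y := (hf.smooth_Dt.hasDerivAt_x' t x y).deriv.symm

end Smooth3

/-- The Pavlov–Mikhalev equation differentiated in `x`. -/
theorem PMu.deriv_x {u : ℝ → ℝ → ℝ → ℝ} (hu : Smooth3 u) (h : PMu u) (t x y : ℝ) :
    Dx (Dy (Dy u)) t x y =
      Dx (Dt (Dx u)) t x y
        - (Dx (Dx u) t x y * Dy (Dx u) t x y + Dx u t x y * Dx (Dy (Dx u)) t x y)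
        + (Dx (Dy u) t x y * Dx (Dx u) t x y + Dy u t x y * Dx (Dx (Dx u)) t x y) := by
  have hux := hu.smooth_Dx
  exact HasDerivAt.deriv (((hux.smooth_Dt.hasDerivAt_x t x y).sub
    ((hux.hasDerivAt_x t x y).mul (hux.smooth_Dy.hasDerivAt_x t x y))).add
    ((hu.smooth_Dy.hasDerivAt_x t x y).mul (hux.smooth_Dx.hasDerivAt_x t x y))
    |>.congr_of_eventuallyEq (.of_forall fun s => h t s y))

/-- The Pavlov–Mikhalev equation differentiated in `y`. -/
theorem PMu.deriv_y {u : ℝ → ℝ → ℝ → ℝ} (hu : Smooth3 u) (h : PMu u) (t x y : ℝ) :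
    Dy (Dy (Dy u)) t x y =
      Dy (Dt (Dx u)) t x y
        - (Dy (Dx u) t x y * Dy (Dx u) t x y + Dx u t x y * Dy (Dy (Dx u)) t x y)
        + (Dy (Dy u) t x y * Dx (Dx u) t x y + Dy u t x y * Dy (Dx (Dx u)) t x y) := by
  have hux := hu.smooth_Dx
  exact HasDerivAt.deriv (((hux.smooth_Dt.hasDerivAt_y t x y).sub
    ((hux.hasDerivAt_y t x y).mul (hux.smooth_Dy.hasDerivAt_y t x y))).add
    ((hu.smooth_Dy.hasDerivAt_y t x y).mul (hux.smooth_Dx.hasDerivAt_y t x y))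
    |>.congr_of_eventuallyEq (.of_forall fun s => h t x s))

/-- The second equation of the Pavlov–Mikhalev system differentiated in `x`. -/
theorem PMv.deriv_x {u v : ℝ → ℝ → ℝ → ℝ} (hu : Smooth3 u) (hv : Smooth3 v) (h : PMv u v)
    (t x y : ℝ) :
    Dx (Dy (Dy v)) t x y =
      Dx (Dt (Dx v)) t x y
        - (Dx (Dx u) t x y * Dy (Dx v) t x y + Dx u t x y * Dx (Dy (Dx v)) t x y)
        - (2 * Dx (Dy v) t x y * Dx (Dx u) t x y + 2 * Dy v t x y * Dx (Dx (Dx u)) t x y)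
        + (2 * Dx (Dx v) t x y * Dy (Dx u) t x y + 2 * Dx v t x y * Dx (Dy (Dx u)) t x y)
        + (Dx (Dy u) t x y * Dx (Dx v) t x y + Dy u t x y * Dx (Dx (Dx v)) t x y) := by
  have hux := hu.smooth_Dx
  have hvx := hv.smooth_Dx
  exact HasDerivAt.deriv (((((hvx.smooth_Dt.hasDerivAt_x t x y).sub
    ((hux.hasDerivAt_x t x y).mul (hvx.smooth_Dy.hasDerivAt_x t x y))).sub
    (((hv.smooth_Dy.hasDerivAt_x t x y).const_mul 2).mul (hux.smooth_Dx.hasDerivAt_x t x y))).add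
    (((hvx.hasDerivAt_x t x y).const_mul 2).mul (hux.smooth_Dy.hasDerivAt_x t x y))).add
    ((hu.smooth_Dy.hasDerivAt_x t x y).mul (hvx.smooth_Dx.hasDerivAt_x t x y))
    |>.congr_of_eventuallyEq (.of_forall fun s => h t s y))

/-- The second equation of the Pavlov–Mikhalev system differentiated in `y`. -/
theorem PMv.deriv_y {u v : ℝ → ℝ → ℝ → ℝ} (hu : Smooth3 u) (hv : Smooth3 v) (h : PMv u v)
    (t x y : ℝ) :
    Dy (Dy (Dy v)) t x y =
      Dy (Dt (Dx v)) t x y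
        - (Dy (Dx u) t x y * Dy (Dx v) t x y + Dx u t x y * Dy (Dy (Dx v)) t x y)
        - (2 * Dy (Dy v) t x y * Dx (Dx u) t x y + 2 * Dy v t x y * Dy (Dx (Dx u)) t x y)
        + (2 * Dy (Dx v) t x y * Dy (Dx u) t x y + 2 * Dx v t x y * Dy (Dy (Dx u)) t x y)
        + (Dy (Dy u) t x y * Dx (Dx v) t x y + Dy u t x y * Dy (Dx (Dx v)) t x y) := by
  have hux := hu.smooth_Dx
  have hvx := hv.smooth_Dx
  exact HasDerivAt.deriv (((((hvx.smooth_Dt.hasDerivAt_y t x y).sub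
    ((hux.hasDerivAt_y t x y).mul (hvx.smooth_Dy.hasDerivAt_y t x y))).sub
    (((hv.smooth_Dy.hasDerivAt_y t x y).const_mul 2).mul (hux.smooth_Dx.hasDerivAt_y t x y))).add
    (((hvx.hasDerivAt_y t x y).const_mul 2).mul (hux.smooth_Dy.hasDerivAt_y t x y))).add
    ((hu.smooth_Dy.hasDerivAt_y t x y).mul (hvx.smooth_Dx.hasDerivAt_y t x y))
    |>.congr_of_eventuallyEq (.of_forall fun s => h t x s))

/-- The common form `g·a(t) + (y·h − c·x)·b(t) − (c/2)·y²·d(t)` of the two components of the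
symmetry. -/
def ansatz (g h : ℝ → ℝ → ℝ → ℝ) (a b d : ℝ → ℝ) (c : ℝ) : ℝ → ℝ → ℝ → ℝ := fun t x y =>
  g t x y * a t + (y * h t x y - c * x) * b t - c / 2 * y ^ 2 * d t

section Ansatz

variable {g h : ℝ → ℝ → ℝ → ℝ} {a b d : ℝ → ℝ} {c : ℝ}

theorem Dx_ansatz (hg : Smooth3 g) (hh : Smooth3 h) :
    Dx (ansatz g h a b d c) =
      fun t x y => Dx g t x y * a t + (y * Dx h t x y - c) * b t := by
  funext t x y
  refine HasDerivAt.deriv (HasDerivAt.congr_deriv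
    ((((hg.hasDerivAt_x t x y).mul_const (a t)).add
    ((((hh.hasDerivAt_x t x y).const_mul y).sub ((hasDerivAt_id x).const_mul c)).mul_const
      (b t))).sub_const (c / 2 * y ^ 2 * d t)) ?_)
  ring

theorem Dy_ansatz (hg : Smooth3 g) (hh : Smooth3 h) :
    Dy (ansatz g h a b d c) =
      fun t x y => Dy g t x y * a t + (h t x y + y * Dy h t x y) * b t - c * y * d t := by
  funext t x y
  refine HasDerivAt.deriv (HasDerivAt.congr_deriv
    ((((hg.hasDerivAt_y t x y).mul_const (a t)).add
    ((((hasDerivAt_id y).mul (hh.hasDerivAt_y t x y)).sub_const (c * x)).mul_const (b t))).sub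
    ((((hasDerivAt_id y).pow 2).const_mul (c / 2)).mul_const (d t))) ?_)
  simp only [id]
  ring

theorem Dx_Dx_ansatz (hg : Smooth3 g) (hh : Smooth3 h) (t x y : ℝ) :
    Dx (Dx (ansatz g h a b d c)) t x y =
      Dx (Dx g) t x y * a t + y * Dx (Dx h) t x y * b t := by
  rw [Dx_ansatz hg hh]
  exact (((hg.smooth_Dx.hasDerivAt_x t x y).mul_const (a t)).add
    ((((hh.smooth_Dx.hasDerivAt_x t x y).const_mul y).sub_const c).mul_const (b t))).deriv

theorem Dy_Dx_ansatz (hg : Smooth3 g) (hh : Smooth3 h) (t x y : ℝ) :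
    Dy (Dx (ansatz g h a b d c)) t x y =
      Dy (Dx g) t x y * a t + (Dx h t x y + y * Dy (Dx h) t x y) * b t := by
  rw [Dx_ansatz hg hh]
  refine HasDerivAt.deriv (HasDerivAt.congr_deriv
    (((hg.smooth_Dx.hasDerivAt_y t x y).mul_const (a t)).add
    ((((hasDerivAt_id y).mul (hh.smooth_Dx.hasDerivAt_y t x y)).sub_const c).mul_const (b t))) ?_)
  simp only [id]
  ring

theorem Dy_Dy_ansatz (hg : Smooth3 g) (hh : Smooth3 h) (t x y : ℝ) :
    Dy (Dy (ansatz g h a b d c)) t x y =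
      Dy (Dy g) t x y * a t + (2 * Dy h t x y + y * Dy (Dy h) t x y) * b t - c * d t := by
  rw [Dy_ansatz hg hh]
  refine HasDerivAt.deriv (HasDerivAt.congr_deriv
    ((((hg.smooth_Dy.hasDerivAt_y t x y).mul_const (a t)).add
    (((hh.hasDerivAt_y t x y).add
      ((hasDerivAt_id y).mul (hh.smooth_Dy.hasDerivAt_y t x y))).mul_const (b t))).sub
    (((hasDerivAt_id y).const_mul c).mul_const (d t))) ?_)
  simp only [id]
  ring

theorem Dt_Dx_ansatz (hg : Smooth3 g) (hh : Smooth3 h) {t : ℝ} (ha : HasDerivAt a (b t) t)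
    (hb : HasDerivAt b (d t) t) (x y : ℝ) :
    Dt (Dx (ansatz g h a b d c)) t x y =
      Dt (Dx g) t x y * a t + (Dx g t x y + y * Dt (Dx h) t x y) * b t
        + (y * Dx h t x y - c) * d t := by
  rw [Dx_ansatz hg hh]
  refine HasDerivAt.deriv (HasDerivAt.congr_deriv
    (((hg.smooth_Dx.hasDerivAt_t t x y).mul ha).add
    ((((hh.smooth_Dx.hasDerivAt_t t x y).const_mul y).sub_const c).mul hb)) ?_)
  ring

end Ansatz

theorem phi5_is_symmetry (u v : ℝ → ℝ → ℝ → ℝ) (hu : Smooth3 u) (hv : Smooth3 v)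
    (hPMu : PMu u) (hPMv : PMv u v)
    (ϑ : ℝ → ℝ) (hϑ : ContDiff ℝ (⊤ : ℕ∞) ϑ) :
    IsSymmetry u v
      (fun t x y => Dy u t x y * ϑ t + (y * Dx u t x y - x) * deriv ϑ t - (1/2) * y^2 * deriv (deriv ϑ) t)
      (fun t x y => Dy v t x y * ϑ t + y * Dx v t x y * deriv ϑ t) := by
  have hϑ₁ : ∀ t, HasDerivAt ϑ (deriv ϑ t) t := fun t =>
    (hϑ.differentiable (by simp) t).hasDerivAt
  have hϑ₂ : ∀ t, HasDerivAt (deriv ϑ) (deriv (deriv ϑ) t) t := fun t =>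
    ((contDiff_infty_iff_deriv.1 hϑ).2.differentiable (by simp) t).hasDerivAt
  have hA : (fun t x y => Dy u t x y * ϑ t + (y * Dx u t x y - x) * deriv ϑ t
      - (1/2) * y^2 * deriv (deriv ϑ) t) =
      ansatz (Dy u) (Dx u) ϑ (deriv ϑ) (deriv (deriv ϑ)) 1 := by
    funext t x y
    simp [ansatz]
  have hB : (fun t x y => Dy v t x y * ϑ t + y * Dx v t x y * deriv ϑ t) =
      ansatz (Dy v) (Dx v) ϑ (deriv ϑ) (deriv (deriv ϑ)) 0 := by
    funext t x y
    simp [ansatz]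
  have hux := hu.smooth_Dx
  have huy := hu.smooth_Dy
  have hvx := hv.smooth_Dx
  have hvy := hv.smooth_Dy
  rw [hA, hB]
  constructor <;> intro t x y
  · have e₁ := hPMu.deriv_x hu t x y
    have e₂ := hPMu.deriv_y hu t x y
    simp only [Dy_Dy_ansatz huy hux, Dt_Dx_ansatz huy hux (hϑ₁ t) (hϑ₂ t),
      Dx_Dx_ansatz huy hux, Dy_Dx_ansatz huy hux]
    simp only [Dx_ansatz huy hux, Dy_ansatz huy hux]
    simp only [hu.Dx_Dy, huy.Dx_Dy, hux.Dx_Dy, hux.Dt_Dy, hux.Dt_Dx] at e₁ e₂ ⊢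
    linear_combination ϑ t * e₂ + y * deriv ϑ t * e₁
  · have e₁ := hPMv.deriv_x hu hv t x y
    have e₂ := hPMv.deriv_y hu hv t x y
    simp only [Dy_Dy_ansatz hvy hvx, Dt_Dx_ansatz hvy hvx (hϑ₁ t) (hϑ₂ t),
      Dx_Dx_ansatz hvy hvx, Dy_Dx_ansatz hvy hvx,
      Dx_Dx_ansatz huy hux, Dy_Dx_ansatz huy hux]
    simp only [Dx_ansatz hvy hvx, Dy_ansatz hvy hvx, Dx_ansatz huy hux, Dy_ansatz huy hux]
    simp only [hu.Dx_Dy, hux.Dx_Dy, hv.Dx_Dy, hvy.Dx_Dy, hvx.Dx_Dy, hvx.Dt_Dy,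
      hvx.Dt_Dx] at e₁ e₂ ⊢
    linear_combination ϑ t * e₂ + y * deriv ϑ t * e₁
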